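/- arXiv:1805.01871 — 2 statements merged into one kernel-verified Lean document; each statement's English description precedes it below -/
import Mathlib

section
/- Let β₀, β₁, β₂, β₃ be four pairwise orthogonal roots in the root system R of type D₄. Then there exists an element w of the Weyl group W of R such that {w(β₀), −w(β₀), w(β₁), −w(β₁), w(β₂), −w(β₂), w(β₃), −w(β₃)} = {±(ε₁ + ε₂), ±(ε₁ − ε₂), ±(ε₃ + ε₄), ±(ε₃ − ε₄)} as subsets of ℝ⁴. -/
noncomputable section

open RealInnerProductSpace

/-- The standard orthonormal basis vectors of `ℝ⁴`. -/
def eps (i : Fin 4) : EuclideanSpace ℝ (Fin 4) := EuclideanSpace.single i 1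

/-- The root system of type `D₄`: the 24 vectors `±εᵢ ± εⱼ` for `1 ≤ i < j ≤ 4`. -/
def D4 : Set (EuclideanSpace ℝ (Fin 4)) :=
  {v | ∃ i j : Fin 4, i < j ∧
    (v = eps i + eps j ∨ v = eps i - eps j ∨ v = -(eps i + eps j) ∨ v = -(eps i - eps j))}

/-- A linear isometry of `ℝ⁴` is a `D₄`-reflection if it is the reflection
`x ↦ x − (2⟨x,γ⟩/⟨γ,γ⟩)γ` in some root `γ ∈ D₄`. -/
def IsD4Reflection (f : EuclideanSpace ℝ (Fin 4) ≃ₗᵢ[ℝ] EuclideanSpace ℝ (Fin 4)) : Prop :=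
  ∃ γ ∈ D4, ∀ x, f x = x - (2 * ⟪x, γ⟫ / ⟪γ, γ⟫) • γ

/-- The Weyl group of `D₄`: the subgroup of the group of linear isometries of `ℝ⁴`
generated by the reflections in the roots of `D₄`. -/
def WeylD4 : Subgroup (EuclideanSpace ℝ (Fin 4) ≃ₗᵢ[ℝ] EuclideanSpace ℝ (Fin 4)) :=
  Subgroup.closure {f | IsD4Reflection f}

/-- The frame of four orthogonal roots obtained from `ε₁ ± ε₂, ε₃ ± ε₄` by permuting
coordinates. -/
def frame (p : Equiv.Perm (Fin 4)) : Fin 4 → EuclideanSpace ℝ (Fin 4) :=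
  ![eps (p 0) + eps (p 1), eps (p 0) - eps (p 1), eps (p 2) + eps (p 3), eps (p 2) - eps (p 3)]

/-- The transposition `(1, k + 1)` of the coordinate indices `0, 1, 2, 3`. It pairs `0` with
`k + 1`, so these three permutations give the three frames of `D₄`. -/
def frameSwap (k : Fin 3) : Equiv.Perm (Fin 4) := Equiv.swap 1 k.succ

lemma inner_eps (i j : Fin 4) : ⟪eps i, eps j⟫ = if i = j then (1 : ℝ) else 0 := by
  simp [eps, EuclideanSpace.inner_single_left]

lemma exists_eq_frame {α : EuclideanSpace ℝ (Fin 4)} (hα : α ∈ D4) :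
    ∃ k j, α = frame (frameSwap k) j ∨ α = -frame (frameSwap k) j := by
  have key : ∀ a b : Fin 4, a < b → ∃ k : Fin 3,
      (frameSwap k 0 = a ∧ frameSwap k 1 = b) ∨ (frameSwap k 2 = a ∧ frameSwap k 3 = b) ∨
      (frameSwap k 2 = b ∧ frameSwap k 3 = a) := by
    unfold frameSwap
    decide
  obtain ⟨a, b, hab, h⟩ := hα
  obtain ⟨k, ⟨rfl, rfl⟩ | ⟨rfl, rfl⟩ | ⟨rfl, rfl⟩⟩ := key a b hab <;> refine ⟨k, ?_⟩
  all_goals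
    rcases h with rfl | rfl | rfl | rfl <;>
      simp [frame, Fin.exists_fin_succ, add_comm]

/-- Two roots from the three frames are orthogonal only if they are distinct members of the
same frame. -/
lemma eq_and_ne_of_inner_frame_eq_zero {k l : Fin 3} {i j : Fin 4}
    (h : ⟪frame (frameSwap k) i, frame (frameSwap l) j⟫ = 0) : k = l ∧ i ≠ j := by
  revert h
  fin_cases k <;> fin_cases l <;> fin_cases i <;> fin_cases j <;>
    simp [frame, frameSwap, inner_add_left, inner_add_right, inner_sub_left, inner_sub_right,
      inner_eps, Equiv.swap_apply_def, -inner_self_eq_norm_sq_to_K]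

lemma exists_mem_WeylD4_swap (i j : Fin 4) :
    ∃ w ∈ WeylD4, ∀ l, w (eps l) = eps (Equiv.swap i j l) := by
  obtain rfl | hij := eq_or_ne i j
  · exact ⟨1, one_mem _, by simp⟩
  refine ⟨LinearIsometryEquiv.piLpCongrLeft 2 ℝ ℝ (Equiv.swap i j),
    Subgroup.subset_closure ⟨eps i - eps j, ?_, fun x ↦ ?_⟩, fun l ↦ ?_⟩
  · rcases hij.lt_or_gt with h | h
    · exact ⟨i, j, h, by simp⟩
    · exact ⟨j, i, h, by simp⟩
  · have h : ⟪eps i - eps j, eps i - eps j⟫ = (2 : ℝ) := by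
      simp only [inner_sub_left, inner_sub_right, inner_eps, hij, hij.symm, if_true, if_false]
      norm_num
    rw [h]
    ext l
    simp only [LinearIsometryEquiv.piLpCongrLeft_apply, Equiv.piCongrLeft'_apply]
    by_cases hi : l = i <;> by_cases hj : l = j <;>
      simp_all [eps, inner_sub_right, EuclideanSpace.inner_single_right,
        Equiv.swap_apply_of_ne_of_ne]
  · simp [eps]

lemma exists_mem_WeylD4_frame (k : Fin 3) :
    ∃ w ∈ WeylD4, ∀ j, w (frame (frameSwap k) j) = frame 1 j := by
  obtain ⟨w, hw, h⟩ := exists_mem_WeylD4_swap 1 k.succ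
  refine ⟨w, hw, fun j ↦ ?_⟩
  fin_cases j <;> simp [frame, frameSwap, h]

/-- Four pairwise orthogonal roots are, up to signs and order, the members of one frame. -/
lemma exists_perm_frame {b : Fin 4 → EuclideanSpace ℝ (Fin 4)} (hb : ∀ i, b i ∈ D4)
    (horth : Pairwise fun i j ↦ ⟪b i, b j⟫ = 0) :
    ∃ (k : Fin 3) (σ : Equiv.Perm (Fin 4)), ∀ i,
      b i = frame (frameSwap k) (σ i) ∨ b i = -frame (frameSwap k) (σ i) := by
  choose k σ h using fun i ↦ exists_eq_frame (hb i)
  have key : ∀ i j, i ≠ j → k i = k j ∧ σ i ≠ σ j := fun i j hij ↦ by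
    apply eq_and_ne_of_inner_frame_eq_zero
    have := horth hij
    rcases h i with hi | hi <;> rcases h j with hj | hj <;> simpa [hi, hj] using this
  have hinj : Function.Injective σ := fun i j hij ↦ by
    by_contra hne
    exact (key i j hne).2 hij
  refine ⟨k 0, Equiv.ofBijective σ (Finite.injective_iff_bijective.mp hinj), fun i ↦ ?_⟩
  have hk : k i = k 0 := by
    obtain rfl | hi := eq_or_ne i 0
    · rfl
    · exact (key i 0 hi).1
  simpa [hk] using h i

/-- Any quadruple of pairwise orthogonal roots of `D₄` can be moved by an element of the
Weyl group, up to signs, to the standard quadruple `ε₁ + ε₂, ε₁ − ε₂, ε₃ + ε₄, ε₃ − ε₄`. -/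
theorem D4_orthogonal_quadruple_conjugate_to_standard
    (β₀ β₁ β₂ β₃ : EuclideanSpace ℝ (Fin 4))
    (h₀ : β₀ ∈ D4) (h₁ : β₁ ∈ D4) (h₂ : β₂ ∈ D4) (h₃ : β₃ ∈ D4)
    (h₀₁ : ⟪β₀, β₁⟫ = 0) (h₀₂ : ⟪β₀, β₂⟫ = 0) (h₀₃ : ⟪β₀, β₃⟫ = 0)
    (h₁₂ : ⟪β₁, β₂⟫ = 0) (h₁₃ : ⟪β₁, β₃⟫ = 0) (h₂₃ : ⟪β₂, β₃⟫ = 0) :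
    ∃ w ∈ WeylD4,
      ({w β₀, -(w β₀), w β₁, -(w β₁), w β₂, -(w β₂), w β₃, -(w β₃)} :
          Set (EuclideanSpace ℝ (Fin 4))) =
      ({eps 0 + eps 1, -(eps 0 + eps 1), eps 0 - eps 1, -(eps 0 - eps 1),
        eps 2 + eps 3, -(eps 2 + eps 3), eps 2 - eps 3, -(eps 2 - eps 3)} :
          Set (EuclideanSpace ℝ (Fin 4))) := by
  have horth : Pairwise fun i j ↦ ⟪![β₀, β₁, β₂, β₃] i, ![β₀, β₁, β₂, β₃] j⟫ = 0 := by
    intro i j hij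
    fin_cases i <;> fin_cases j <;> simp_all [real_inner_comm]
  obtain ⟨k, σ, hσ⟩ := exists_perm_frame (b := ![β₀, β₁, β₂, β₃])
    (by simp [Fin.forall_fin_succ, *]) horth
  obtain ⟨w, hw, hwf⟩ := exists_mem_WeylD4_frame k
  have hwb : ∀ v i, (v = w (![β₀, β₁, β₂, β₃] i) ∨ v = -w (![β₀, β₁, β₂, β₃] i)) ↔
      (v = frame 1 (σ i) ∨ v = -frame 1 (σ i)) := fun v i ↦ by
    rcases hσ i with h | h <;> simp [h, hwf, or_comm]
  refine ⟨w, hw, Set.ext fun v ↦ ?_⟩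
  have h := (exists_congr (hwb v)).trans
    (σ.surjective.exists (p := fun j ↦ v = frame 1 j ∨ v = -frame 1 j)).symm
  simpa [Fin.exists_fin_succ, frame, or_assoc] using h
end
end

section
/- Let β₀, β₁, β₂, β₃ and β₀′, β₁′, β₂′, β₃′ be two quadruples of pairwise orthogonal roots in the root system R of type D₄, and let Θ = {±β₀, ±β₁, ±β₂, ±β₃} and Θ′ = {±β₀′, ±β₁′, ±β₂′, ±β₃′}. Then there exists an element w of the Weyl group W of R such that w(Θ) = Θ′. -/
noncomputable section

open RealInnerProductSpace

/-- The roots of `D₄` are the integral vectors of squared length `2`. -/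
theorem mem_D4_iff {v : EuclideanSpace ℝ (Fin 4)} :
    v ∈ D4 ↔ (∀ i, ∃ n : ℤ, v i = n) ∧ ⟪v, v⟫ = 2 := by
  constructor
  · rintro ⟨i, j, hij, hv⟩
    refine ⟨fun k => ?_, ?_⟩
    · rcases hv with rfl | rfl | rfl | rfl
      · exact ⟨(if k = i then 1 else 0) + (if k = j then 1 else 0), by simp [eps]⟩
      · exact ⟨(if k = i then 1 else 0) - (if k = j then 1 else 0), by simp [eps]⟩
      · exact ⟨-((if k = i then 1 else 0) + (if k = j then 1 else 0)), by simp [eps]⟩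
      · exact ⟨-((if k = i then 1 else 0) - (if k = j then 1 else 0)), by simp [eps]⟩
    · have hii (l : Fin 4) : ⟪eps l, eps l⟫ = 1 := by simp [eps]
      have h : ⟪eps i, eps j⟫ = 0 := by
        rw [eps, eps, EuclideanSpace.inner_single_left]
        simp [hij.ne]
      have h' : ⟪eps j, eps i⟫ = 0 := by rw [real_inner_comm, h]
      rcases hv with rfl | rfl | rfl | rfl <;>
        simp only [inner_neg_neg, inner_add_left, inner_add_right, inner_sub_left,
          inner_sub_right, hii, h, h'] <;> norm_num
  · rintro ⟨hint, hv⟩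
    choose n hn using hint
    have hsum : n 0 ^ 2 + n 1 ^ 2 + n 2 ^ 2 + n 3 ^ 2 = 2 := by
      have h := hv
      simp only [PiLp.inner_apply, Fin.sum_univ_four, hn, RCLike.inner_apply, conj_trivial] at h
      norm_cast at h
      linarith
    have hbd (i : Fin 4) : n i = -1 ∨ n i = 0 ∨ n i = 1 := by
      have : n i ^ 2 ≤ 2 := by fin_cases i <;> simp <;> nlinarith
      have h1 : -2 < n i := by nlinarith
      have h2 : n i < 2 := by nlinarith
      omega
    have hpair : ∃ i j, i < j ∧ n i ≠ 0 ∧ n j ≠ 0 ∧ ∀ k, k ≠ i → k ≠ j → n k = 0 := by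
      rcases hbd 0 with h0 | h0 | h0 <;> rcases hbd 1 with h1 | h1 | h1 <;>
        rcases hbd 2 with h2 | h2 | h2 <;> rcases hbd 3 with h3 | h3 | h3 <;>
        simp [h0, h1, h2, h3] at hsum <;>
        simp [Fin.exists_fin_succ, Fin.forall_fin_succ, h0, h1, h2, h3]
    obtain ⟨i, j, hij, hi, hj, hk⟩ := hpair
    have hvn : v = (n i : ℝ) • eps i + (n j : ℝ) • eps j := by
      ext k
      rcases eq_or_ne k i with rfl | hki
      · simp [eps, hn, hij.ne]
      rcases eq_or_ne k j with rfl | hkj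
      · simp [eps, hn, hij.ne']
      simp [eps, hn, hk k hki hkj, hki, hkj]
    refine ⟨i, j, hij, ?_⟩
    rcases hbd i with h | h | h <;> rcases hbd j with h' | h' | h' <;>
      first
      | exact absurd h hi
      | exact absurd h' hj
      | (rw [h, h'] at hvn
         simp only [Int.cast_neg, Int.cast_one, neg_smul, one_smul] at hvn
         rw [hvn])
    · right; right; left; abel
    · right; right; right; abel
    · right; left; abel
    · left; rfl

theorem inner_self_of_mem_D4 {v : EuclideanSpace ℝ (Fin 4)} (hv : v ∈ D4) : ⟪v, v⟫ = 2 :=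
  (mem_D4_iff.1 hv).2

theorem exists_int_inner_of_mem_D4 {v w : EuclideanSpace ℝ (Fin 4)} (hv : v ∈ D4)
    (hw : w ∈ D4) : ∃ n : ℤ, ⟪v, w⟫ = n := by
  choose a ha using (mem_D4_iff.1 hv).1
  choose b hb using (mem_D4_iff.1 hw).1
  exact ⟨∑ i, b i * a i, by simp [PiLp.inner_apply, ha, hb]⟩

theorem neg_mem_D4 {v : EuclideanSpace ℝ (Fin 4)} (hv : v ∈ D4) : -v ∈ D4 := by
  obtain ⟨h, h'⟩ := mem_D4_iff.1 hv
  refine mem_D4_iff.2 ⟨fun i => ?_, by rwa [inner_neg_neg]⟩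
  obtain ⟨n, hn⟩ := h i
  exact ⟨-n, by simp [hn]⟩

theorem sub_mem_D4 {v w : EuclideanSpace ℝ (Fin 4)} (hv : v ∈ D4) (hw : w ∈ D4)
    (h : ⟪v, w⟫ = 1) : v - w ∈ D4 := by
  refine mem_D4_iff.2 ⟨fun i => ?_, ?_⟩
  · obtain ⟨a, ha⟩ := (mem_D4_iff.1 hv).1 i
    obtain ⟨b, hb⟩ := (mem_D4_iff.1 hw).1 i
    exact ⟨a - b, by simp [ha, hb]⟩
  · rw [real_inner_sub_sub_self, inner_self_of_mem_D4 hv, inner_self_of_mem_D4 hw, h]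
    norm_num

theorem IsD4Reflection.map_mem_D4
    {f : EuclideanSpace ℝ (Fin 4) ≃ₗᵢ[ℝ] EuclideanSpace ℝ (Fin 4)} (hf : IsD4Reflection f)
    {v : EuclideanSpace ℝ (Fin 4)} (hv : v ∈ D4) : f v ∈ D4 := by
  obtain ⟨γ, hγ, hfγ⟩ := hf
  refine mem_D4_iff.2 ⟨fun i => ?_, by rw [f.inner_map_map, inner_self_of_mem_D4 hv]⟩
  obtain ⟨a, ha⟩ := (mem_D4_iff.1 hv).1 i
  obtain ⟨b, hb⟩ := (mem_D4_iff.1 hγ).1 i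
  obtain ⟨n, hn⟩ := exists_int_inner_of_mem_D4 hv hγ
  refine ⟨a - n * b, ?_⟩
  rw [hfγ, inner_self_of_mem_D4 hγ]
  simp [hn, ha, hb]

/-- Two roots of `D₄` with inner product `1` are exchanged by a reflection. -/
theorem exists_isD4Reflection_map_eq {v w : EuclideanSpace ℝ (Fin 4)} (hv : v ∈ D4)
    (hw : w ∈ D4) (h : ⟪v, w⟫ = 1) : ∃ f, IsD4Reflection f ∧ f v = w := by
  have hδ := sub_mem_D4 hv hw h
  have hf (x) : (ℝ ∙ (v - w))ᗮ.reflection x =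
      x - (2 * ⟪x, v - w⟫ / ⟪v - w, v - w⟫) • (v - w) := by
    rw [Submodule.reflection_orthogonal_apply, Submodule.reflection_singleton_apply,
      real_inner_comm, RCLike.ofReal_real_eq_id, id, ← real_inner_self_eq_norm_sq, neg_sub,
      two_smul, ← add_smul]
    congr 2
    ring
  refine ⟨_, ⟨v - w, hδ, hf⟩, ?_⟩
  rw [hf, inner_self_of_mem_D4 hδ, inner_sub_right, inner_self_of_mem_D4 hv, h]
  norm_num

/-- A family of four pairwise orthogonal roots of `D₄`. -/
structure IsOrthogonalQuadruple (b : Fin 4 → EuclideanSpace ℝ (Fin 4)) : Prop where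
  mem : ∀ i, b i ∈ D4
  orthogonal : Pairwise fun i j => ⟪b i, b j⟫ = 0

namespace IsOrthogonalQuadruple

variable {b b' : Fin 4 → EuclideanSpace ℝ (Fin 4)} {v : EuclideanSpace ℝ (Fin 4)}

/-- Parseval's identity for the orthogonal basis `b`, evaluated at a root. -/
theorem sum_sq_inner (hb : IsOrthogonalQuadruple b) (hv : v ∈ D4) :
    ∑ i, ⟪v, b i⟫ ^ 2 = 4 := by
  have hs : (√2)⁻¹ * (√2)⁻¹ = (2⁻¹ : ℝ) := by
    rw [← mul_inv, Real.mul_self_sqrt zero_le_two]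
  have ho : Orthonormal ℝ fun i => (√2)⁻¹ • b i := by
    rw [orthonormal_iff_ite]
    intro i j
    rw [real_inner_smul_left, real_inner_smul_right, ← mul_assoc, hs]
    split_ifs with hij
    · subst hij
      rw [inner_self_of_mem_D4 (hb.mem i)]
      norm_num
    · rw [hb.orthogonal hij, mul_zero]
  let B := OrthonormalBasis.mk ho
    (ho.linearIndependent.span_eq_top_of_card_eq_finrank (by simp)).ge
  have hB (i) : ⟪v, B i⟫ ^ 2 = 2⁻¹ * ⟪v, b i⟫ ^ 2 := by
    simp only [B, OrthonormalBasis.coe_mk, real_inner_smul_right]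
    rw [mul_pow, pow_two (√2)⁻¹, hs]
  have h := B.sum_sq_inner_left v
  rw [← real_inner_self_eq_norm_sq, inner_self_of_mem_D4 hv] at h
  simp only [hB, ← Finset.mul_sum] at h
  linarith

/-- A root not in `±b` has inner product `±1` with every member of `b`. -/
theorem eq_or_eq_neg_or_inner (hb : IsOrthogonalQuadruple b) (hv : v ∈ D4) :
    (∃ i, v = b i ∨ v = -b i) ∨ ∀ i, ⟪v, b i⟫ = 1 ∨ ⟪v, b i⟫ = -1 := by
  choose n hn using fun i => exists_int_inner_of_mem_D4 hv (hb.mem i)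
  have hsum : n 0 ^ 2 + n 1 ^ 2 + n 2 ^ 2 + n 3 ^ 2 = 4 := by
    have h := hb.sum_sq_inner hv
    simp only [hn, Fin.sum_univ_four] at h
    exact_mod_cast h
  have hbd (i : Fin 4) : -2 ≤ n i ∧ n i ≤ 2 := by
    have : n i ^ 2 ≤ 4 := by fin_cases i <;> simp <;> nlinarith
    exact ⟨by nlinarith, by nlinarith⟩
  by_cases hex : ∃ i, n i = 2 ∨ n i = -2
  · left
    obtain ⟨i, hi⟩ := hex
    refine ⟨i, hi.imp (fun h => ?_) fun h => ?_⟩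
    · rw [← sub_eq_zero, ← inner_self_eq_zero (𝕜 := ℝ), real_inner_sub_sub_self,
        inner_self_of_mem_D4 hv, inner_self_of_mem_D4 (hb.mem i), hn, h]
      norm_num
    · rw [← sub_eq_zero, sub_neg_eq_add, ← inner_self_eq_zero (𝕜 := ℝ), real_inner_add_add_self,
        inner_self_of_mem_D4 hv, inner_self_of_mem_D4 (hb.mem i), hn, h]
      norm_num
  · right
    push Not at hex
    have hle (i : Fin 4) : n i ^ 2 ≤ 1 := by
      have := hbd i
      have := hex i
      have : -1 ≤ n i := by omega
      have : n i ≤ 1 := by omega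
      nlinarith
    intro i
    have : n i ^ 2 = 1 := by
      have := hle 0
      have := hle 1
      have := hle 2
      have := hle 3
      match i with
      | 0 | 1 | 2 | 3 => linarith
    rw [hn]
    exact_mod_cast sq_eq_one_iff.1 this

/-- The set `±b` is determined by any one of its members. -/
theorem setOf_subset (hb : IsOrthogonalQuadruple b) (hb' : IsOrthogonalQuadruple b')
    {j k : Fin 4} (h : b j = b' k ∨ b j = -b' k) :
    {x | ∃ i, x = b i ∨ x = -b i} ⊆ {x | ∃ i, x = b' i ∨ x = -b' i} := by
  have key (i) : ∃ l, b i = b' l ∨ b i = -b' l := by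
    rcases eq_or_ne i j with rfl | hij
    · exact ⟨k, h⟩
    have h0 : ⟪b i, b' k⟫ = 0 := by
      have := hb.orthogonal hij
      rcases h with h | h <;> simpa [h] using this
    refine (hb'.eq_or_eq_neg_or_inner (hb.mem i)).resolve_right fun h1 => ?_
    rcases h1 k with h1 | h1 <;> norm_num [h0] at h1
  rintro x ⟨i, hx⟩
  obtain ⟨l, hl⟩ := key i
  refine ⟨l, ?_⟩
  rcases hx with rfl | rfl <;> rcases hl with hl | hl <;> simp [hl]

theorem setOf_eq (hb : IsOrthogonalQuadruple b) (hb' : IsOrthogonalQuadruple b')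
    {j k : Fin 4} (h : b j = b' k ∨ b j = -b' k) :
    {x | ∃ i, x = b i ∨ x = -b i} = {x | ∃ i, x = b' i ∨ x = -b' i} :=
  (hb.setOf_subset hb' h).antisymm <| hb'.setOf_subset hb (j := k) (k := j) <| by
    rcases h with h | h <;> simp [h]

theorem comp_isD4Reflection (hb : IsOrthogonalQuadruple b)
    {f : EuclideanSpace ℝ (Fin 4) ≃ₗᵢ[ℝ] EuclideanSpace ℝ (Fin 4)} (hf : IsD4Reflection f) :
    IsOrthogonalQuadruple (f ∘ b) where
  mem i := hf.map_mem_D4 (hb.mem i)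
  orthogonal i j hij := by simpa using hb.orthogonal hij

theorem exists_mem_weylD4_image_eq (hb : IsOrthogonalQuadruple b)
    (hb' : IsOrthogonalQuadruple b') :
    ∃ w ∈ WeylD4, w '' {x | ∃ i, x = b i ∨ x = -b i} = {x | ∃ i, x = b' i ∨ x = -b' i} := by
  rcases hb'.eq_or_eq_neg_or_inner (hb.mem 0) with ⟨k, hk⟩ | h
  · exact ⟨1, one_mem _, by simpa using hb.setOf_eq hb' hk⟩
  · obtain ⟨f, hf, hf0⟩ : ∃ f, IsD4Reflection f ∧ (f (b 0) = b' 0 ∨ f (b 0) = -b' 0) := by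
      rcases h 0 with h | h
      · obtain ⟨f, hf, h⟩ := exists_isD4Reflection_map_eq (hb.mem 0) (hb'.mem 0) h
        exact ⟨f, hf, .inl h⟩
      · obtain ⟨f, hf, h⟩ := exists_isD4Reflection_map_eq (hb.mem 0) (neg_mem_D4 (hb'.mem 0))
          (by rw [inner_neg_right, h, neg_neg])
        exact ⟨f, hf, .inr h⟩
    refine ⟨f, Subgroup.subset_closure hf, ?_⟩
    rw [← (hb.comp_isD4Reflection hf).setOf_eq hb' (j := 0) (k := 0) hf0]
    ext x
    constructor
    · rintro ⟨y, ⟨i, rfl | rfl⟩, rfl⟩ <;> exact ⟨i, by simp⟩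
    · rintro ⟨i, rfl | rfl⟩
      · exact ⟨b i, ⟨i, .inl rfl⟩, rfl⟩
      · exact ⟨-b i, ⟨i, .inr rfl⟩, by simp⟩

end IsOrthogonalQuadruple

theorem isOrthogonalQuadruple_cons {β₀ β₁ β₂ β₃ : EuclideanSpace ℝ (Fin 4)}
    (h₀ : β₀ ∈ D4) (h₁ : β₁ ∈ D4) (h₂ : β₂ ∈ D4) (h₃ : β₃ ∈ D4)
    (h₀₁ : ⟪β₀, β₁⟫ = 0) (h₀₂ : ⟪β₀, β₂⟫ = 0) (h₀₃ : ⟪β₀, β₃⟫ = 0)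
    (h₁₂ : ⟪β₁, β₂⟫ = 0) (h₁₃ : ⟪β₁, β₃⟫ = 0) (h₂₃ : ⟪β₂, β₃⟫ = 0) :
    IsOrthogonalQuadruple ![β₀, β₁, β₂, β₃] where
  mem i := by fin_cases i <;> assumption
  orthogonal i j hij := by
    fin_cases i <;> fin_cases j <;>
      first
      | exact absurd rfl hij
      | assumption
      | (rw [real_inner_comm]; assumption)

theorem insert_neg_eq_setOf (β₀ β₁ β₂ β₃ : EuclideanSpace ℝ (Fin 4)) :
    ({β₀, -β₀, β₁, -β₁, β₂, -β₂, β₃, -β₃} : Set (EuclideanSpace ℝ (Fin 4))) =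
      {x | ∃ i, x = ![β₀, β₁, β₂, β₃] i ∨ x = -![β₀, β₁, β₂, β₃] i} := by
  ext x
  simp [Fin.exists_fin_succ, or_assoc]


/-- Any two sets `Θ = {±β₀, ±β₁, ±β₂, ±β₃}` and `Θ′ = {±β₀′, ±β₁′, ±β₂′, ±β₃′}` arising
from quadruples of pairwise orthogonal roots of `D₄` are conjugate under the Weyl group. -/
theorem D4_orthogonal_quadruples_weyl_conjugate
    (β₀ β₁ β₂ β₃ β₀' β₁' β₂' β₃' : EuclideanSpace ℝ (Fin 4))
    (h₀ : β₀ ∈ D4) (h₁ : β₁ ∈ D4) (h₂ : β₂ ∈ D4) (h₃ : β₃ ∈ D4)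
    (h₀' : β₀' ∈ D4) (h₁' : β₁' ∈ D4) (h₂' : β₂' ∈ D4) (h₃' : β₃' ∈ D4)
    (h₀₁ : ⟪β₀, β₁⟫ = 0) (h₀₂ : ⟪β₀, β₂⟫ = 0) (h₀₃ : ⟪β₀, β₃⟫ = 0)
    (h₁₂ : ⟪β₁, β₂⟫ = 0) (h₁₃ : ⟪β₁, β₃⟫ = 0) (h₂₃ : ⟪β₂, β₃⟫ = 0)
    (h₀₁' : ⟪β₀', β₁'⟫ = 0) (h₀₂' : ⟪β₀', β₂'⟫ = 0) (h₀₃' : ⟪β₀', β₃'⟫ = 0)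
    (h₁₂' : ⟪β₁', β₂'⟫ = 0) (h₁₃' : ⟪β₁', β₃'⟫ = 0) (h₂₃' : ⟪β₂', β₃'⟫ = 0) :
    ∃ w ∈ WeylD4,
      (⇑w) '' ({β₀, -β₀, β₁, -β₁, β₂, -β₂, β₃, -β₃} : Set (EuclideanSpace ℝ (Fin 4))) =
        ({β₀', -β₀', β₁', -β₁', β₂', -β₂', β₃', -β₃'} : Set (EuclideanSpace ℝ (Fin 4))) := by
  rw [insert_neg_eq_setOf, insert_neg_eq_setOf]
  exact (isOrthogonalQuadruple_cons h₀ h₁ h₂ h₃ h₀₁ h₀₂ h₀₃ h₁₂ h₁₃ h₂₃).exists_mem_weylD4_image_eq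
    (isOrthogonalQuadruple_cons h₀' h₁' h₂' h₃' h₀₁' h₀₂' h₀₃' h₁₂' h₁₃' h₂₃')
end
end
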